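/- arXiv:2310.19383 — 7 statements merged into one kernel-verified Lean document; each statement's English description precedes it below -/
import Mathlib

section
/- Let e and e' be empirical models on the same measurement scenario (X, M, O), and let ε > 0. If V(e, e') ≤ ε, then |CF(e) − CF(e')| ≤ |M|·ε, where |M| is the number of contexts. -/
/-- Joint outcome assignments for the measurements in `U`. -/
abbrev Assign {X : Type} (O : X → Type) (U : Finset X) : Type :=
  (x : {x : X // x ∈ U}) → O x.1

/-- Marginalisation of a (sub)distribution on `O_U` to `O_V` for `V ⊆ U`. -/
noncomputable def marginal {X : Type} [DecidableEq X] {O : X → Type}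
    [∀ x, Fintype (O x)] [∀ x, DecidableEq (O x)]
    {U V : Finset X} (h : V ⊆ U) (d : Assign O U → ℝ) : Assign O V → ℝ :=
  fun t => ∑ s : Assign O U,
    if (fun x : {x : X // x ∈ V} => s ⟨x.1, h x.2⟩) = t then d s else 0

/-- A model on the scenario with contexts `M`: a real-valued table for each context. -/
abbrev Model {X : Type} (O : X → Type) (M : Finset (Finset X)) : Type :=
  (C : {C : Finset X // C ∈ M}) → Assign O C.1 → ℝ

/-- `M` is a covering family of contexts for `X`. -/
def Covers {X : Type} (M : Finset (Finset X)) : Prop :=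
  ∀ x : X, ∃ C ∈ M, x ∈ C

/-- An empirical model: each context carries a probability distribution. -/
def IsEmpirical {X : Type} [DecidableEq X] {O : X → Type} [∀ x, Fintype (O x)]
    {M : Finset (Finset X)} (e : Model O M) : Prop :=
  ∀ C, (∀ s, 0 ≤ e C s) ∧ (∑ s, e C s) = 1

/-- Non-signalling: marginals agree on intersections of contexts. -/
def NonSignalling {X : Type} [DecidableEq X] {O : X → Type}
    [∀ x, Fintype (O x)] [∀ x, DecidableEq (O x)]
    {M : Finset (Finset X)} (e : Model O M) : Prop :=
  ∀ C C' : {C : Finset X // C ∈ M},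
    marginal (Finset.inter_subset_left : C.1 ∩ C'.1 ⊆ C.1) (e C) =
      marginal (Finset.inter_subset_right : C.1 ∩ C'.1 ⊆ C'.1) (e C')

/-- Deterministic: each context carries a Dirac (point-mass) distribution. -/
def Deterministic {X : Type} [DecidableEq X] {O : X → Type} [∀ x, DecidableEq (O x)]
    {M : Finset (Finset X)} (e : Model O M) : Prop :=
  ∀ C, ∃ s₀ : Assign O C.1, ∀ s, e C s = if s = s₀ then 1 else 0

/-- Marginal of a function on global assignments to the context `C`. -/
noncomputable def globMarg {X : Type} [Fintype X] [DecidableEq X] (O : X → Type)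
    [∀ x, Fintype (O x)] [∀ x, DecidableEq (O x)]
    (C : Finset X) (b : (∀ x, O x) → ℝ) : Assign O C → ℝ :=
  fun t => ∑ g : ∀ x, O x,
    if (fun x : {x : X // x ∈ C} => g x.1) = t then b g else 0

/-- The noncontextual fraction. -/
noncomputable def NCF {X : Type} [Fintype X] [DecidableEq X] {O : X → Type}
    [∀ x, Fintype (O x)] [∀ x, DecidableEq (O x)]
    {M : Finset (Finset X)} (e : Model O M) : ℝ :=
  sSup { r | ∃ b : (∀ x, O x) → ℝ, (∀ g, 0 ≤ b g) ∧
    (∀ C : {C : Finset X // C ∈ M}, ∀ t, globMarg O C.1 b t ≤ e C t) ∧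
    r = ∑ g, b g }

/-- The contextual fraction. -/
noncomputable def CF {X : Type} [Fintype X] [DecidableEq X] {O : X → Type}
    [∀ x, Fintype (O x)] [∀ x, DecidableEq (O x)]
    {M : Finset (Finset X)} (e : Model O M) : ℝ :=
  1 - NCF e

/-- The non-signalling fraction. -/
noncomputable def NSF {X : Type} [Fintype X] [DecidableEq X] {O : X → Type}
    [∀ x, Fintype (O x)] [∀ x, DecidableEq (O x)]
    {M : Finset (Finset X)} (e : Model O M) : ℝ :=
  sSup { r | ∃ b : (∀ x, O x) → ℝ,
    (∀ C : {C : Finset X // C ∈ M}, ∀ t,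
      0 ≤ globMarg O C.1 b t ∧ globMarg O C.1 b t ≤ e C t) ∧
    r = ∑ g, b g }

/-- The signalling fraction. -/
noncomputable def SF {X : Type} [Fintype X] [DecidableEq X] {O : X → Type}
    [∀ x, Fintype (O x)] [∀ x, DecidableEq (O x)]
    {M : Finset (Finset X)} (e : Model O M) : ℝ :=
  1 - NSF e

/-- The maximum incompatibility of marginals. -/
noncomputable def MIM {X : Type} [DecidableEq X] {O : X → Type}
    [∀ x, Fintype (O x)] [∀ x, DecidableEq (O x)]
    {M : Finset (Finset X)} (e : Model O M) : ℝ :=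
  sSup { r | ∃ C C' : {C : Finset X // C ∈ M}, C.1 ≠ C'.1 ∧
    ∃ t : Assign O (C.1 ∩ C'.1),
      r = |marginal (Finset.inter_subset_left : C.1 ∩ C'.1 ⊆ C.1) (e C) t -
            marginal (Finset.inter_subset_right : C.1 ∩ C'.1 ⊆ C'.1) (e C') t| }

/-- The generalised total variation distance between two models. -/
noncomputable def tvDist {X : Type} [DecidableEq X] {O : X → Type}
    [∀ x, Fintype (O x)]
    {M : Finset (Finset X)} (e e' : Model O M) : ℝ :=
  sSup { r | ∃ C : {C : Finset X // C ∈ M}, r = (1/2) * ∑ s, |e C s - e' C s| }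

theorem one_sub_sum_le_prod_one_sub {ι : Type*} (s : Finset ι) (d : ι → ℝ)
    (h0 : ∀ i, 0 ≤ d i) (h1 : ∀ i, d i ≤ 1) :
    1 - ∑ i ∈ s, d i ≤ ∏ i ∈ s, (1 - d i) := by
  classical
  induction s using Finset.induction_on with
  | empty => simp
  | insert a s ha ih =>
    rw [Finset.sum_insert ha, Finset.prod_insert ha]
    have hs : 0 ≤ ∑ i ∈ s, d i := Finset.sum_nonneg fun i _ => h0 i
    nlinarith [mul_le_mul_of_nonneg_left ih (sub_nonneg.2 (h1 a)), mul_nonneg (h0 a) hs]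

section

variable {X : Type} [DecidableEq X] {O : X → Type} [∀ x, Fintype (O x)]
  {M : Finset (Finset X)}

theorem half_sum_abs_sub_le_tvDist (e e' : Model O M) (C : {C : Finset X // C ∈ M}) :
    (1 / 2) * ∑ s, |e C s - e' C s| ≤ tvDist e e' := by
  refine le_csSup ?_ ⟨C, rfl⟩
  refine ((Set.finite_range
    fun C : {C : Finset X // C ∈ M} => (1 / 2) * ∑ s, |e C s - e' C s|).subset ?_).bddAbove
  rintro r ⟨C, rfl⟩
  exact ⟨C, rfl⟩

theorem tvDist_comm (e e' : Model O M) : tvDist e e' = tvDist e' e := by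
  simp only [tvDist, abs_sub_comm]

theorem sum_max_sub_zero_le_tvDist {e e' : Model O M} (he : IsEmpirical e)
    (he' : IsEmpirical e') (C : {C : Finset X // C ∈ M}) :
    ∑ t, max (e C t - e' C t) 0 ≤ tvDist e e' := by
  refine le_of_eq_of_le ?_ (half_sum_abs_sub_le_tvDist e e' C)
  have hmax : ∀ t, max (e C t - e' C t) 0 =
      (1 / 2) * |e C t - e' C t| + (1 / 2) * (e C t - e' C t) := fun t => by
    rcases le_total (e C t - e' C t) 0 with h | h
    · rw [max_eq_right h, abs_of_nonpos h]; ring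
    · rw [max_eq_left h, abs_of_nonneg h]; ring
  simp only [hmax, Finset.sum_add_distrib, ← Finset.mul_sum, Finset.sum_sub_distrib,
    (he C).2, (he' C).2]
  ring

end

section

variable {X : Type} [Fintype X] [DecidableEq X] {O : X → Type}
  [∀ x, Fintype (O x)] [∀ x, DecidableEq (O x)] {M : Finset (Finset X)}

/-- Integrating a function of the restriction to `C` against the marginal on `C`. -/
theorem sum_globMarg_mul (C : Finset X) (b : (∀ x, O x) → ℝ) (f : Assign O C → ℝ) :
    ∑ t, globMarg O C b t * f t = ∑ g, b g * f (fun x => g x.1) := by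
  simp only [globMarg, Finset.sum_mul, ite_mul, zero_mul]
  rw [Finset.sum_comm]
  simp

theorem sum_globMarg (C : Finset X) (b : (∀ x, O x) → ℝ) :
    ∑ t, globMarg O C b t = ∑ g, b g := by
  simpa using sum_globMarg_mul C b 1

theorem globMarg_le_mul {C : Finset X} {b b' : (∀ x, O x) → ℝ} {f : Assign O C → ℝ}
    (h : ∀ g, b' g ≤ b g * f (fun x => g x.1)) (t : Assign O C) :
    globMarg O C b' t ≤ globMarg O C b t * f t := by
  simp only [globMarg, Finset.sum_mul]
  refine Finset.sum_le_sum fun g _ => ?_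
  split_ifs with hg
  · exact hg ▸ h g
  · simp

/-- The weights of subdistributions on global assignments dominated by `e` are bounded. -/
theorem bddAbove_noncontextual_weights (hM : M.Nonempty) {e : Model O M} (he : IsEmpirical e) :
    BddAbove { r | ∃ b : (∀ x, O x) → ℝ, (∀ g, 0 ≤ b g) ∧
      (∀ C : {C : Finset X // C ∈ M}, ∀ t, globMarg O C.1 b t ≤ e C t) ∧
      r = ∑ g, b g } := by
  obtain ⟨C, hC⟩ := hM
  refine ⟨1, ?_⟩
  rintro r ⟨b, -, hb, rfl⟩
  rw [← sum_globMarg C b, ← (he ⟨C, hC⟩).2]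
  exact Finset.sum_le_sum fun t _ => hb ⟨C, hC⟩ t

theorem NCF_le_NCF_add_card_mul_tvDist (hM : M.Nonempty) {e e' : Model O M}
    (he : IsEmpirical e) (he' : IsEmpirical e') :
    NCF e ≤ NCF e' + M.card * tvDist e e' := by
  refine csSup_le ⟨0, 0, fun _ => le_rfl, fun C t => ?_, by simp⟩ ?_
  · simpa [globMarg] using (he C).1 t
  rintro r ⟨b, hb0, hb, rfl⟩
  -- the fraction of the mass of `e C t` which has to be removed to get below `e' C t`
  let d : (C : {C : Finset X // C ∈ M}) → Assign O C.1 → ℝ :=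
    fun C t => max (e C t - e' C t) 0 / e C t
  have hd0 : ∀ C t, 0 ≤ d C t := fun C t => div_nonneg (le_max_right _ _) ((he C).1 t)
  have hd1 : ∀ C t, d C t ≤ 1 := fun C t => div_le_one_of_le₀
    (max_le (sub_le_self _ ((he' C).1 t)) ((he C).1 t)) ((he C).1 t)
  have hed : ∀ C t, e C t * d C t = max (e C t - e' C t) 0 := fun C t => by
    rcases eq_or_ne (e C t) 0 with h | h
    · simp [h, (he' C).1 t]
    · exact mul_div_cancel₀ _ h
  let w : (∀ x, O x) → ℝ := fun g => ∏ C : {C : Finset X // C ∈ M}, (1 - d C fun x => g x.1)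
  have hw0 : ∀ g, 0 ≤ w g := fun g => Finset.prod_nonneg fun C _ => sub_nonneg.2 (hd1 C _)
  have hw : ∀ C g, w g ≤ 1 - d C fun x => g x.1 := fun C g => by
    refine (Finset.mul_prod_erase Finset.univ _ (Finset.mem_univ C)).symm.trans_le ?_
    refine mul_le_of_le_one_right (sub_nonneg.2 (hd1 C _)) (Finset.prod_le_one ?_ ?_)
    · exact fun C _ => sub_nonneg.2 (hd1 C _)
    · exact fun C _ => sub_le_self _ (hd0 C _)
  have hmem : ∑ g, b g * w g ≤ NCF e' := by
    refine le_csSup (bddAbove_noncontextual_weights hM he')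
      ⟨fun g => b g * w g, fun g => mul_nonneg (hb0 g) (hw0 g), fun C t => ?_, rfl⟩
    calc globMarg O C.1 (fun g => b g * w g) t
        ≤ globMarg O C.1 b t * (1 - d C t) :=
          globMarg_le_mul (f := fun t => 1 - d C t)
            (fun g => mul_le_mul_of_nonneg_left (hw C g) (hb0 g)) t
      _ ≤ e C t * (1 - d C t) := mul_le_mul_of_nonneg_right (hb C t) (sub_nonneg.2 (hd1 C t))
      _ ≤ e' C t := by
          rw [mul_sub, mul_one, hed]
          linarith [le_max_left (e C t - e' C t) 0]
  have hloss : ∑ g, b g * ∑ C, d C (fun x => g x.1) ≤ M.card * tvDist e e' := by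
    simp only [Finset.mul_sum]
    rw [Finset.sum_comm]
    have hC : ∀ C ∈ Finset.univ, ∑ g, b g * d C (fun x => g x.1) ≤ tvDist e e' := fun C _ => by
      rw [← sum_globMarg_mul]
      refine le_trans (Finset.sum_le_sum fun t _ => ?_) (sum_max_sub_zero_le_tvDist he he' C)
      exact (mul_le_mul_of_nonneg_right (hb C t) (hd0 C t)).trans_eq (hed C t)
    simpa using Finset.sum_le_card_nsmul _ _ _ hC
  have hsplit : ∑ g, b g ≤ ∑ g, b g * w g + ∑ g, b g * ∑ C, d C (fun x => g x.1) := by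
    rw [← Finset.sum_add_distrib]
    refine Finset.sum_le_sum fun g _ => ?_
    have := one_sub_sum_le_prod_one_sub Finset.univ (fun C => d C fun x => g x.1)
      (fun C => hd0 C _) (fun C => hd1 C _)
    nlinarith [mul_le_mul_of_nonneg_left this (hb0 g)]
  linarith

end

theorem continuity_of_contextual_fraction {X : Type} [Fintype X] [DecidableEq X] {O : X → Type}
    [∀ x, Fintype (O x)] [∀ x, DecidableEq (O x)] [∀ x, Nonempty (O x)]
    {M : Finset (Finset X)} (hM : Covers M)
    (e e' : Model O M) (he : IsEmpirical e) (he' : IsEmpirical e')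
    (ε : ℝ) (hε : 0 < ε) (hV : tvDist e e' ≤ ε) :
    |CF e - CF e'| ≤ (M.card : ℝ) * ε := by
  rcases M.eq_empty_or_nonempty with rfl | hne
  · have : e = e' := funext fun C => absurd C.2 (Finset.notMem_empty _)
    simp [this]
  · have h := NCF_le_NCF_add_card_mul_tvDist hne he he'
    have h' := NCF_le_NCF_add_card_mul_tvDist hne he' he
    rw [tvDist_comm e' e] at h'
    have hcard := mul_le_mul_of_nonneg_left hV (Nat.cast_nonneg (α := ℝ) M.card)
    rw [abs_le, CF, CF]
    constructor <;> linarith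
end

section
/- Let h be an empirical model on a measurement scenario (X, M, O) admitting a decomposition h = (1−η)·h_OD + η·h' where h_OD is a deterministic empirical model that is not non-signalling, h' is an empirical model, and η < 1/2. Then MIM(h) ≥ 1 − 2η. -/
section Marginal

variable {X : Type} [DecidableEq X] {O : X → Type}
  [∀ x, Fintype (O x)] [∀ x, DecidableEq (O x)] {U V : Finset X}

theorem marginal_nonneg (hVU : V ⊆ U) {d : Assign O U → ℝ} (hd : ∀ s, 0 ≤ d s)
    (t : Assign O V) : 0 ≤ marginal hVU d t := by
  refine Finset.sum_nonneg fun s _ => ?_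
  split_ifs
  exacts [hd s, le_rfl]

theorem marginal_le_sum (hVU : V ⊆ U) {d : Assign O U → ℝ} (hd : ∀ s, 0 ≤ d s)
    (t : Assign O V) : marginal hVU d t ≤ ∑ s, d s := by
  refine Finset.sum_le_sum fun s _ => ?_
  split_ifs
  exacts [le_rfl, hd s]

theorem marginal_add_smul (hVU : V ⊆ U) (a b : ℝ) (d d' : Assign O U → ℝ) (t : Assign O V) :
    marginal hVU (a • d + b • d') t = a * marginal hVU d t + b * marginal hVU d' t := by
  simp only [marginal, Finset.mul_sum, ← Finset.sum_add_distrib]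
  refine Finset.sum_congr rfl fun s _ => ?_
  split_ifs <;> simp

/-- The marginal of a point mass takes only the values `0` and `1`. -/
theorem marginal_dirac_eq_zero_or_one (hVU : V ⊆ U) {d : Assign O U → ℝ} {s₀ : Assign O U}
    (hd : ∀ s, d s = if s = s₀ then 1 else 0) (t : Assign O V) :
    marginal hVU d t = 0 ∨ marginal hVU d t = 1 := by
  have key : marginal hVU d t =
      if (fun x : {x : X // x ∈ V} => s₀ ⟨x.1, hVU x.2⟩) = t then 1 else 0 := by
    unfold marginal
    rw [Finset.sum_eq_single s₀]
    · simp [hd]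
    · intro s _ hs
      simp [hd, hs]
    · simp
  rw [key]
  split_ifs <;> simp

variable {M : Finset (Finset X)}

theorem IsEmpirical.marginal_mem_Icc {e : Model O M} (he : IsEmpirical e)
    (C : {C : Finset X // C ∈ M}) (hV : V ⊆ C.1) (t : Assign O V) :
    marginal hV (e C) t ∈ Set.Icc (0 : ℝ) 1 :=
  ⟨marginal_nonneg hV (he C).1 t, (marginal_le_sum hV (he C).1 t).trans_eq (he C).2⟩

theorem IsEmpirical.abs_marginal_sub_le_MIM {e : Model O M} (he : IsEmpirical e)
    {C C' : {C : Finset X // C ∈ M}} (hne : C.1 ≠ C'.1) (t : Assign O (C.1 ∩ C'.1)) :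
    |marginal (Finset.inter_subset_left : C.1 ∩ C'.1 ⊆ C.1) (e C) t -
      marginal (Finset.inter_subset_right : C.1 ∩ C'.1 ⊆ C'.1) (e C') t| ≤ MIM e := by
  refine le_csSup ⟨1, ?_⟩ ⟨C, C', hne, t, rfl⟩
  rintro _ ⟨D, D', -, u, rfl⟩
  exact (abs_sub_le_of_nonneg_of_le
    (he.marginal_mem_Icc D Finset.inter_subset_left u).1
    (he.marginal_mem_Icc D Finset.inter_subset_left u).2
    (he.marginal_mem_Icc D' Finset.inter_subset_right u).1
    (he.marginal_mem_Icc D' Finset.inter_subset_right u).2)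

end Marginal

theorem MIM_lower_bound {X : Type} [Fintype X] [DecidableEq X] {O : X → Type}
    [∀ x, Fintype (O x)] [∀ x, DecidableEq (O x)] [∀ x, Nonempty (O x)]
    {M : Finset (Finset X)} (hM : Covers M)
    (h hOD h' : Model O M)
    (hhE : IsEmpirical h) (hODE : IsEmpirical hOD) (h'E : IsEmpirical h')
    (hdet : Deterministic hOD) (hsig : ¬ NonSignalling hOD)
    (η : ℝ) (hη0 : 0 ≤ η) (hη : η < 1/2)
    (hdec : h = (1-η) • hOD + η • h') :
    1 - 2*η ≤ MIM h := by
  simp only [NonSignalling, not_forall] at hsig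
  obtain ⟨C, C', hCC'⟩ := hsig
  have hne : C.1 ≠ C'.1 := by
    intro heq
    obtain rfl := Subtype.ext heq
    exact hCC' rfl
  obtain ⟨t, ht⟩ := Function.ne_iff.mp hCC'
  refine le_trans ?_ (hhE.abs_marginal_sub_le_MIM hne t)
  have hC : h C = (1-η) • hOD C + η • h' C := by rw [hdec]; rfl
  have hC' : h C' = (1-η) • hOD C' + η • h' C' := by rw [hdec]; rfl
  rw [hC, hC', marginal_add_smul, marginal_add_smul]
  obtain ⟨s, hs⟩ := hdet C
  obtain ⟨s', hs'⟩ := hdet C'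
  obtain ⟨p0, p1⟩ := h'E.marginal_mem_Icc C Finset.inter_subset_left t
  obtain ⟨q0, q1⟩ := h'E.marginal_mem_Icc C' Finset.inter_subset_right t
  have hp0 := mul_nonneg hη0 p0
  have hq0 := mul_nonneg hη0 q0
  have hp1 := mul_le_of_le_one_right hη0 p1
  have hq1 := mul_le_of_le_one_right hη0 q1
  rcases marginal_dirac_eq_zero_or_one Finset.inter_subset_left hs t with ha | ha <;>
    rcases marginal_dirac_eq_zero_or_one Finset.inter_subset_right hs' t with hb | hb
  · exact absurd (ha.trans hb.symm) ht
  · rw [ha, hb, le_abs]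
    right
    linarith
  · rw [ha, hb, le_abs]
    left
    linarith
  · exact absurd (ha.trans hb.symm) ht
end

section
/- Let h be an empirical model on a measurement scenario (X, M, O) with a decomposition h = (1−β)·h_OD + β·h' where h_OD is a deterministic empirical model, h' is an empirical model, and β ∈ [0,1]. Then for every deterministic empirical model d with d ≠ h_OD and every r ∈ [0,1] such that r·d_C(s) ≤ h_C(s) for all C ∈ M and all s ∈ O_C, one has r ≤ β. -/
theorem closest_deterministic_point {X : Type} [Fintype X] [DecidableEq X] {O : X → Type}
    [∀ x, Fintype (O x)] [∀ x, DecidableEq (O x)] [∀ x, Nonempty (O x)]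
    {M : Finset (Finset X)} (hM : Covers M)
    (h hOD h' : Model O M) (hODE : IsEmpirical hOD) (h'E : IsEmpirical h')
    (hdet : Deterministic hOD)
    (β : ℝ) (hβ : β ∈ Set.Icc (0:ℝ) 1)
    (hdec : h = (1-β) • hOD + β • h')
    (d : Model O M) (hdE : IsEmpirical d) (hddet : Deterministic d) (hne : d ≠ hOD)
    (r : ℝ) (hr : r ∈ Set.Icc (0:ℝ) 1)
    (hle : ∀ C s, r * d C s ≤ h C s) :
    r ≤ β := by
  obtain ⟨C, hC⟩ := Function.ne_iff.mp hne
  obtain ⟨s₀, hs₀⟩ := hdet C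
  obtain ⟨s₁, hs₁⟩ := hddet C
  have hs : s₁ ≠ s₀ := by
    rintro rfl
    exact hC (funext fun s => (hs₁ s).trans (hs₀ s).symm)
  have h'_le_one : h' C s₁ ≤ 1 :=
    (h'E C).2 ▸ Finset.single_le_sum (fun s _ => (h'E C).1 s) (Finset.mem_univ s₁)
  have hle₁ : r ≤ β * h' C s₁ := by
    simpa [hdec, hs₀, hs₁, hs] using hle C s₁
  exact hle₁.trans (mul_le_of_le_one_right hβ.1 h'_le_one)
end

section
/- Let h1 and h2 be empirical models on a measurement scenario (X, M, O) such that CF((1/2)·h1 + (1/2)·h2) = 1. Then for every α ∈ [1/2, 1], CF(α·h1 + (1−α)·h2) = 1. -/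
/-- Every context bounds the weight of the global subdistributions below a model. -/
theorem bddAbove_NCF_set {X : Type} [Fintype X] [DecidableEq X] {O : X → Type}
    [∀ x, Fintype (O x)] [∀ x, DecidableEq (O x)]
    {M : Finset (Finset X)} (e : Model O M) (C : {C : Finset X // C ∈ M}) :
    BddAbove { r | ∃ b : (∀ x, O x) → ℝ, (∀ g, 0 ≤ b g) ∧
      (∀ C : {C : Finset X // C ∈ M}, ∀ t, globMarg O C.1 b t ≤ e C t) ∧
      r = ∑ g, b g } := by
  refine ⟨∑ t, e C t, ?_⟩
  rintro r ⟨b, -, hb, rfl⟩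
  calc ∑ g, b g = ∑ t, globMarg O C.1 b t := by
        unfold globMarg
        rw [Finset.sum_comm]
        simp
    _ ≤ ∑ t, e C t := Finset.sum_le_sum fun t _ => hb C t

/-- Vanishing of the noncontextual fraction passes to models dominated by a positive multiple. -/
theorem NCF_eq_zero_of_le_smul {X : Type} [Fintype X] [DecidableEq X] {O : X → Type}
    [∀ x, Fintype (O x)] [∀ x, DecidableEq (O x)]
    {M : Finset (Finset X)} {e e' : Model O M} {c : ℝ} (hc : 0 < c)
    (hle : e' ≤ c • e) (he : NCF e = 0) : NCF e' = 0 := by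
  rcases isEmpty_or_nonempty {C : Finset X // C ∈ M} with hM | ⟨⟨C⟩⟩
  · rwa [Subsingleton.elim e' e]
  apply le_antisymm
  · apply Real.sSup_nonpos
    rintro r ⟨b, hb0, hb, rfl⟩
    have hmem : ∑ g, c⁻¹ * b g ≤ NCF e := by
      refine le_csSup (bddAbove_NCF_set e C)
        ⟨fun g => c⁻¹ * b g, fun g => mul_nonneg (inv_nonneg.2 hc.le) (hb0 g), fun D t => ?_, rfl⟩
      have hmarg : globMarg O D.1 (fun g => c⁻¹ * b g) t = c⁻¹ * globMarg O D.1 b t := by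
        simp only [globMarg, Finset.mul_sum, mul_ite, mul_zero]
      rw [hmarg, inv_mul_le_iff₀ hc]
      exact (hb D t).trans (hle D t)
    rw [he, ← Finset.mul_sum] at hmem
    exact nonpos_of_mul_nonpos_right hmem (inv_pos.2 hc)
  · apply Real.sSup_nonneg
    rintro r ⟨b, hb0, -, rfl⟩
    exact Finset.sum_nonneg fun g _ => hb0 g

theorem CF_one_of_half_mixture {X : Type} [Fintype X] [DecidableEq X] {O : X → Type}
    [∀ x, Fintype (O x)] [∀ x, DecidableEq (O x)] [∀ x, Nonempty (O x)]
    {M : Finset (Finset X)} (hM : Covers M)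
    (h1 h2 : Model O M) (he1 : IsEmpirical h1) (he2 : IsEmpirical h2)
    (hcf : CF ((1/2 : ℝ) • h1 + (1/2 : ℝ) • h2) = 1)
    (α : ℝ) (hα : α ∈ Set.Icc (1/2 : ℝ) 1) :
    CF (α • h1 + (1-α) • h2) = 1 := by
  unfold CF at hcf ⊢
  have hle : α • h1 + (1-α) • h2 ≤ (2 : ℝ) • ((1/2 : ℝ) • h1 + (1/2 : ℝ) • h2) := by
    intro C t
    have p1 := (he1 C).1 t
    have p2 := (he2 C).1 t
    simp only [Pi.add_apply, Pi.smul_apply, smul_eq_mul]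
    nlinarith [hα.1, hα.2]
  rw [NCF_eq_zero_of_le_smul two_pos hle (by linarith), sub_zero]
end

section
/- The contextual fraction is convex: for empirical models e1, e2 on a measurement scenario (X, M, O) and λ ∈ [0,1], CF(λ·e1 + (1−λ)·e2) ≤ λ·CF(e1) + (1−λ)·CF(e2). -/
theorem IsEmpirical.smul_add_smul {X : Type} [DecidableEq X] {O : X → Type}
    [∀ x, Fintype (O x)] {M : Finset (Finset X)} {e₁ e₂ : Model O M}
    (he₁ : IsEmpirical e₁) (he₂ : IsEmpirical e₂) {a c : ℝ} (ha : 0 ≤ a) (hc : 0 ≤ c) (hac : a + c = 1) :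
    IsEmpirical (a • e₁ + c • e₂) := by
  refine fun C => ⟨fun s => ?_, ?_⟩
  · exact add_nonneg (mul_nonneg ha ((he₁ C).1 s)) (mul_nonneg hc ((he₂ C).1 s))
  · simp [Finset.sum_add_distrib, ← Finset.mul_sum, (he₁ C).2, (he₂ C).2, hac]

/-- The total weights of the subdistributions on global assignments dominated by `e`. -/
def noncontextualWeights {X : Type} [Fintype X] [DecidableEq X] {O : X → Type}
    [∀ x, Fintype (O x)] [∀ x, DecidableEq (O x)]
    {M : Finset (Finset X)} (e : Model O M) : Set ℝ :=
  { r | ∃ b : (∀ x, O x) → ℝ, (∀ g, 0 ≤ b g) ∧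
    (∀ C : {C : Finset X // C ∈ M}, ∀ t, globMarg O C.1 b t ≤ e C t) ∧
    r = ∑ g, b g }

section

variable {X : Type} [Fintype X] [DecidableEq X] {O : X → Type}
  [∀ x, Fintype (O x)] [∀ x, DecidableEq (O x)] {M : Finset (Finset X)}

theorem globMarg_smul_add_smul (C : Finset X) (a c : ℝ) (b b' : (∀ x, O x) → ℝ)
    (t : Assign O C) :
    globMarg O C (a • b + c • b') t = a * globMarg O C b t + c * globMarg O C b' t := by
  simp only [globMarg, Finset.mul_sum, ← Finset.sum_add_distrib]
  refine Finset.sum_congr rfl fun g _ => ?_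
  split_ifs <;> simp

theorem nonempty_noncontextualWeights {e : Model O M} (he : IsEmpirical e) :
    (noncontextualWeights e).Nonempty :=
  ⟨0, 0, fun _ => le_rfl, fun C t => by simpa [globMarg] using (he C).1 t, by simp⟩

theorem bddAbove_noncontextualWeights {e : Model O M} (he : IsEmpirical e)
    (C : {C : Finset X // C ∈ M}) : BddAbove (noncontextualWeights e) := by
  refine ⟨1, ?_⟩
  rintro r ⟨b, -, hb, rfl⟩
  rw [← sum_globMarg C.1, ← (he C).2]
  exact Finset.sum_le_sum fun t _ => hb C t

open scoped Pointwise in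
theorem smul_add_smul_noncontextualWeights_subset (e₁ e₂ : Model O M) {a c : ℝ}
    (ha : 0 ≤ a) (hc : 0 ≤ c) :
    a • noncontextualWeights e₁ + c • noncontextualWeights e₂ ⊆
      noncontextualWeights (a • e₁ + c • e₂) := by
  rintro _ ⟨_, ⟨_, ⟨b, hb, hbe, rfl⟩, rfl⟩, _, ⟨_, ⟨b', hb', hbe', rfl⟩, rfl⟩, rfl⟩
  refine ⟨a • b + c • b', fun g => ?_, fun C t => ?_, ?_⟩
  · exact add_nonneg (mul_nonneg ha (hb g)) (mul_nonneg hc (hb' g))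
  · rw [globMarg_smul_add_smul]
    exact add_le_add (mul_le_mul_of_nonneg_left (hbe C t) ha)
      (mul_le_mul_of_nonneg_left (hbe' C t) hc)
  · simp [Finset.sum_add_distrib, Finset.mul_sum]

open scoped Pointwise in
theorem le_NCF_smul_add_smul {e₁ e₂ : Model O M} (he₁ : IsEmpirical e₁)
    (he₂ : IsEmpirical e₂) {a c : ℝ} (ha : 0 ≤ a) (hc : 0 ≤ c) (hac : a + c = 1) :
    a * NCF e₁ + c * NCF e₂ ≤ NCF (a • e₁ + c • e₂) := by
  rcases isEmpty_or_nonempty {C : Finset X // C ∈ M} with hM | ⟨⟨C⟩⟩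
  · rw [Subsingleton.elim (a • e₁ + c • e₂) e₁, Subsingleton.elim e₂ e₁, ← add_mul, hac, one_mul]
  · change a • sSup (noncontextualWeights e₁) + c • sSup (noncontextualWeights e₂) ≤
      sSup (noncontextualWeights (a • e₁ + c • e₂))
    have hne₁ := nonempty_noncontextualWeights he₁
    have hne₂ := nonempty_noncontextualWeights he₂
    have hbd₁ := bddAbove_noncontextualWeights he₁ C
    have hbd₂ := bddAbove_noncontextualWeights he₂ C
    rw [← Real.sSup_smul_of_nonneg ha, ← Real.sSup_smul_of_nonneg hc,
      ← csSup_add hne₁.smul_set (hbd₁.smul_of_nonneg ha) hne₂.smul_set (hbd₂.smul_of_nonneg hc)]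
    exact csSup_le_csSup
      (bddAbove_noncontextualWeights (he₁.smul_add_smul he₂ ha hc hac) C)
      (hne₁.smul_set.add hne₂.smul_set)
      (smul_add_smul_noncontextualWeights_subset e₁ e₂ ha hc)

end

theorem CF_convex {X : Type} [Fintype X] [DecidableEq X] {O : X → Type}
    [∀ x, Fintype (O x)] [∀ x, DecidableEq (O x)] [∀ x, Nonempty (O x)]
    {M : Finset (Finset X)} (hM : Covers M)
    (e1 e2 : Model O M) (he1 : IsEmpirical e1) (he2 : IsEmpirical e2)
    (l : ℝ) (hl : l ∈ Set.Icc (0:ℝ) 1) :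
    CF (l • e1 + (1-l) • e2) ≤ l * CF e1 + (1-l) * CF e2 := by
  have h := le_NCF_smul_add_smul he1 he2 hl.1 (sub_nonneg.2 hl.2) (add_sub_cancel l 1)
  unfold CF
  linarith
end

section
/- The PR-box empirical model on the CHSH scenario is non-signalling and is maximally contextual: CF(PR) = 1, i.e. NCF(PR) = 0. -/
/-- The CHSH scenario: measurements `0 = a`, `1 = a'`, `2 = b`, `3 = b'`. -/
def CHSHM : Finset (Finset (Fin 4)) := {{0,2},{0,3},{1,2},{1,3}}

/-- The PR-box empirical model on the CHSH scenario: uniform on joint outcomes of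
odd parity in the context `{a', b'}` and of even parity in the other contexts. -/
noncomputable def PRbox : Model (fun _ : Fin 4 => Fin 2) CHSHM :=
  fun C s =>
    if (∑ x, (s x).val) % 2 = (if C.1 = ({1,3} : Finset (Fin 4)) then 1 else 0)
    then 1/2 else 0

/-- The joint outcomes in the support of the PR box on the context `C`. -/
def PRSupport (C : {C : Finset (Fin 4) // C ∈ CHSHM})
    (s : Assign (fun _ : Fin 4 => Fin 2) C.1) : Prop :=
  (∑ x, (s x).val) % 2 = (if C.1 = ({1,3} : Finset (Fin 4)) then 1 else 0)

instance (C : {C : Finset (Fin 4) // C ∈ CHSHM}) : DecidablePred (PRSupport C) :=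
  fun _ => inferInstanceAs (Decidable (_ = _))

lemma PRbox_apply (C : {C : Finset (Fin 4) // C ∈ CHSHM})
    (s : Assign (fun _ : Fin 4 => Fin 2) C.1) :
    PRbox C s = if PRSupport C s then 1 / 2 else 0 := rfl

lemma card_PRSupport : ∀ C : {C : Finset (Fin 4) // C ∈ CHSHM},
    (Finset.univ.filter (PRSupport C)).card = 2 := by
  decide +kernel

lemma isEmpirical_PRbox : IsEmpirical PRbox := by
  refine fun C => ⟨fun s => ?_, ?_⟩
  · rw [PRbox_apply]
    split_ifs <;> norm_num
  · simp [PRbox_apply, ← Finset.sum_filter, card_PRSupport]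

/-- Restrictions of the PR-box supports to the intersection of two contexts have fibres of the
same size. -/
lemma card_PRSupport_restrict_eq : ∀ (C C' : {C : Finset (Fin 4) // C ∈ CHSHM})
    (t : Assign (fun _ : Fin 4 => Fin 2) (C.1 ∩ C'.1)),
    (Finset.univ.filter fun s : Assign (fun _ : Fin 4 => Fin 2) C.1 =>
      (fun x : {x // x ∈ C.1 ∩ C'.1} => s ⟨x.1, Finset.inter_subset_left x.2⟩) = t ∧
        PRSupport C s).card =
    (Finset.univ.filter fun s : Assign (fun _ : Fin 4 => Fin 2) C'.1 =>
      (fun x : {x // x ∈ C.1 ∩ C'.1} => s ⟨x.1, Finset.inter_subset_right x.2⟩) = t ∧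
        PRSupport C' s).card := by
  decide +kernel

lemma nonSignalling_PRbox : NonSignalling PRbox := by
  intro C C'
  funext t
  simp only [marginal, PRbox_apply, ← ite_and, ← Finset.sum_filter, Finset.sum_const,
    card_PRSupport_restrict_eq C C' t]

/-- No global assignment restricts into the support of the PR box on every context. -/
lemma exists_not_PRSupport_restrict : ∀ g : Fin 4 → Fin 2,
    ∃ C : {C : Finset (Fin 4) // C ∈ CHSHM}, ¬ PRSupport C fun x => g x.1 := by
  decide +kernel

lemma le_globMarg {X : Type} [Fintype X] [DecidableEq X] {O : X → Type}
    [∀ x, Fintype (O x)] [∀ x, DecidableEq (O x)] (C : Finset X) {b : (∀ x, O x) → ℝ}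
    (hb : ∀ g, 0 ≤ b g) (g : ∀ x, O x) : b g ≤ globMarg O C b fun x => g x.1 := by
  have h := Finset.single_le_sum
    (f := fun g' : ∀ x, O x =>
      if (fun x : {x : X // x ∈ C} => g' x.1) = (fun x : {x : X // x ∈ C} => g x.1)
      then b g' else 0)
    (fun g' _ => by split_ifs; exacts [hb g', le_rfl]) (Finset.mem_univ g)
  simpa [globMarg] using h

lemma NCF_PRbox : NCF PRbox = 0 := by
  have hset : { r | ∃ b : (Fin 4 → Fin 2) → ℝ, (∀ g, 0 ≤ b g) ∧
      (∀ C : {C : Finset (Fin 4) // C ∈ CHSHM}, ∀ t,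
        globMarg (fun _ => Fin 2) C.1 b t ≤ PRbox C t) ∧ r = ∑ g, b g } = {0} := by
    ext r
    constructor
    · rintro ⟨b, hb, hle, rfl⟩
      refine Finset.sum_eq_zero fun g _ => le_antisymm ?_ (hb g)
      obtain ⟨C, hC⟩ := exists_not_PRSupport_restrict g
      refine (le_globMarg C.1 hb g).trans ((hle C _).trans_eq ?_)
      rw [PRbox_apply, if_neg hC]
    · rintro rfl
      exact ⟨0, fun _ => le_rfl,
        fun C t => by simpa [globMarg] using (isEmpirical_PRbox C).1 t, by simp⟩
  rw [NCF, hset, csSup_singleton]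

theorem PRbox_nonsignalling_maximally_contextual :
    IsEmpirical PRbox ∧ NonSignalling PRbox ∧ CF PRbox = 1 ∧ NCF PRbox = 0 :=
  ⟨isEmpirical_PRbox, nonSignalling_PRbox, by rw [CF, NCF_PRbox, sub_zero], NCF_PRbox⟩
end

section
/- Let (Λ, p, (h^λ)_{λ∈Λ}) be a hidden-variable model realizing the PR-box on the CHSH scenario, in which every h^λ is non-signalling. Then for every λ ∈ Λ with p(λ) > 0, any decomposition h^λ = (1−η_λ)·h^λ_OD + η_λ·h''^λ with h^λ_OD a deterministic empirical model and h''^λ an empirical model satisfies η_λ ≥ 1/2. -/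
/-- The probability that measurement `i` yields outcome `0` in the context `C`. -/
noncomputable def probZero {X : Type} [DecidableEq X] {C : Finset X}
    (d : Assign (fun _ : X => Fin 2) C → ℝ) (i : {x // x ∈ C}) : ℝ :=
  ∑ s, if s i = 0 then d s else 0

/-- Non-signalling models give well-defined single-measurement probabilities. -/
theorem NonSignalling.probZero_eq {X : Type} [DecidableEq X] {M : Finset (Finset X)}
    {e : Model (fun _ : X => Fin 2) M} (he : NonSignalling e) {C C' : {C // C ∈ M}} {i : X}
    (hi : C.1 ∩ C'.1 = {i}) (hC : i ∈ C.1) (hC' : i ∈ C'.1) :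
    probZero (e C) ⟨i, hC⟩ = probZero (e C') ⟨i, hC'⟩ := by
  have hmem : ∀ x, x ∈ C.1 ∩ C'.1 ↔ x = i := fun x => by rw [hi, Finset.mem_singleton]
  have hzero := congrFun (he C C') (fun _ => 0)
  have hrestrict : ∀ (D : Finset X) (hD : C.1 ∩ C'.1 ⊆ D) (hiD : i ∈ D)
      (s : Assign (fun _ : X => Fin 2) D),
      ((fun x : {x // x ∈ C.1 ∩ C'.1} => s ⟨x.1, hD x.2⟩) = fun _ => 0) ↔ s ⟨i, hiD⟩ = 0 := by
    intro D hD hiD s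
    constructor
    · intro hs
      exact congrFun hs ⟨i, (hmem i).2 rfl⟩
    · intro hs
      funext ⟨x, hx⟩
      obtain rfl := (hmem x).1 hx
      exact hs
  refine Eq.trans ?_ (hzero.trans ?_) <;> refine Finset.sum_congr rfl fun s _ => ?_
  · exact if_congr (hrestrict _ Finset.inter_subset_left hC s).symm rfl rfl
  · exact if_congr (hrestrict _ Finset.inter_subset_right hC' s) rfl rfl

/-- Perfectly correlated measurements have equal outcome probabilities. -/
theorem probZero_eq_of_correlated {X : Type} [DecidableEq X] {C : Finset X}
    {d : Assign (fun _ : X => Fin 2) C → ℝ} {i j : {x // x ∈ C}}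
    (hd : ∀ s, s i ≠ s j → d s = 0) : probZero d i = probZero d j := by
  refine Finset.sum_congr rfl fun s _ => ?_
  by_cases hs : s i = s j
  · rw [hs]
  · simp [hd s hs]

/-- Perfectly anticorrelated measurements have complementary outcome probabilities. -/
theorem probZero_add_of_anticorrelated {X : Type} [DecidableEq X] {C : Finset X}
    {d : Assign (fun _ : X => Fin 2) C → ℝ} {i j : {x // x ∈ C}}
    (hd : ∀ s, s i = s j → d s = 0) : probZero d i + probZero d j = ∑ s, d s := by
  rw [probZero, probZero, ← Finset.sum_add_distrib]
  refine Finset.sum_congr rfl fun s _ => ?_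
  by_cases hs : s i = s j
  · simp [hd s hs]
  · by_cases hi : s i = 0 <;> by_cases hj : s j = 0
    · exact absurd (hi.trans hj.symm) hs
    · simp [hi, hj]
    · simp [hi, hj]
    · exact absurd ((Fin.eq_one_of_ne_zero _ hi).trans (Fin.eq_one_of_ne_zero _ hj).symm) hs

/-- Every joint outcome has probability at most that of the outcome of measurement `i`. -/
theorem le_max_probZero {X : Type} [DecidableEq X] {C : Finset X}
    {d : Assign (fun _ : X => Fin 2) C → ℝ} (hd : ∀ s, 0 ≤ d s) (hd1 : ∑ s, d s = 1)
    (i : {x // x ∈ C}) (s : Assign (fun _ : X => Fin 2) C) :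
    d s ≤ max (probZero d i) (1 - probZero d i) := by
  by_cases hs : s i = 0
  · refine le_max_of_le_left ?_
    have := Finset.single_le_sum (f := fun s => if s i = 0 then d s else 0)
      (fun s _ => by dsimp only; split_ifs <;> simp [hd s]) (Finset.mem_univ s)
    simpa [hs, probZero] using this
  · refine le_max_of_le_right ?_
    have := Finset.single_le_sum (f := fun s => d s - if s i = 0 then d s else 0)
      (fun s _ => by dsimp only; split_ifs <;> simp [hd s]) (Finset.mem_univ s)
    simpa [hs, probZero, Finset.sum_sub_distrib, hd1] using this

/-- A non-signalling empirical model supported within the PR-box has uniform marginals. -/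
theorem probZero_eq_half_of_support_PRbox {e : Model (fun _ : Fin 4 => Fin 2) CHSHM}
    (he : IsEmpirical e) (hNS : NonSignalling e) (hsupp : ∀ C s, PRbox C s = 0 → e C s = 0) :
    probZero (e ⟨{0, 2}, by decide⟩) ⟨0, by decide⟩ = 1 / 2 := by
  have hcorr02 := probZero_eq_of_correlated (d := e ⟨{0, 2}, by decide⟩)
    (i := ⟨0, by decide⟩) (j := ⟨2, by decide⟩) fun s hs => hsupp _ _ <| if_neg <| by
      revert s; decide
  have hcorr03 := probZero_eq_of_correlated (d := e ⟨{0, 3}, by decide⟩)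
    (i := ⟨0, by decide⟩) (j := ⟨3, by decide⟩) fun s hs => hsupp _ _ <| if_neg <| by
      revert s; decide
  have hcorr12 := probZero_eq_of_correlated (d := e ⟨{1, 2}, by decide⟩)
    (i := ⟨1, by decide⟩) (j := ⟨2, by decide⟩) fun s hs => hsupp _ _ <| if_neg <| by
      revert s; decide
  have hanti13 := probZero_add_of_anticorrelated (d := e ⟨{1, 3}, by decide⟩)
    (i := ⟨1, by decide⟩) (j := ⟨3, by decide⟩) fun s hs => hsupp _ _ <| if_neg <| by
      revert s; decide
  rw [(he _).2] at hanti13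
  have hns0 := hNS.probZero_eq (C := ⟨{0, 2}, by decide⟩) (C' := ⟨{0, 3}, by decide⟩) (i := 0)
    (by decide) (by decide) (by decide)
  have hns2 := hNS.probZero_eq (C := ⟨{0, 2}, by decide⟩) (C' := ⟨{1, 2}, by decide⟩) (i := 2)
    (by decide) (by decide) (by decide)
  have hns1 := hNS.probZero_eq (C := ⟨{1, 2}, by decide⟩) (C' := ⟨{1, 3}, by decide⟩) (i := 1)
    (by decide) (by decide) (by decide)
  have hns3 := hNS.probZero_eq (C := ⟨{0, 3}, by decide⟩) (C' := ⟨{1, 3}, by decide⟩) (i := 3)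
    (by decide) (by decide) (by decide)
  linarith

theorem PRbox_HVM_eta_ge_half
    {Λ : Type} [Fintype Λ] (p : Λ → ℝ) (hp0 : ∀ l, 0 ≤ p l) (hp1 : ∑ l, p l = 1)
    (h : Λ → Model (fun _ : Fin 4 => Fin 2) CHSHM)
    (hemp : ∀ l, IsEmpirical (h l)) (hNS : ∀ l, NonSignalling (h l))
    (hreal : ∀ C s, PRbox C s = ∑ l, p l * h l C s)
    (l : Λ) (hpl : 0 < p l)
    (η : ℝ) (hη : η ∈ Set.Icc (0:ℝ) 1)
    (hOD h'' : Model (fun _ : Fin 4 => Fin 2) CHSHM)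
    (hODE : IsEmpirical hOD) (h''E : IsEmpirical h'')
    (hODdet : Deterministic hOD)
    (hdec : h l = (1-η) • hOD + η • h'') :
    1/2 ≤ η := by
  have hsupp : ∀ C s, PRbox C s = 0 → h l C s = 0 := by
    intro C s hPR
    rw [hreal, Finset.sum_eq_zero_iff_of_nonneg
      fun k _ => mul_nonneg (hp0 k) ((hemp k C).1 s)] at hPR
    exact (mul_eq_zero.1 (hPR l (Finset.mem_univ l))).resolve_left hpl.ne'
  have hhalf := probZero_eq_half_of_support_PRbox (hemp l) (hNS l) hsupp
  obtain ⟨s, hs⟩ := hODdet ⟨{0, 2}, by decide⟩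
  have hle := le_max_probZero (hemp l ⟨{0, 2}, by decide⟩).1 (hemp l _).2 ⟨0, by decide⟩ s
  have hval := congrFun (congrFun hdec ⟨{0, 2}, by decide⟩) s
  simp only [Pi.add_apply, Pi.smul_apply, smul_eq_mul, hs, if_true, mul_one] at hval
  have hrest := mul_nonneg hη.1 ((h''E ⟨{0, 2}, by decide⟩).1 s)
  rw [hhalf] at hle
  norm_num at hle
  linarith
end
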